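/- For a convex m-thick lattice polygon B, 2·area(B) + (1/2) ∑_u def_u(B)² ≥ (1/2) m², where the sum runs over primitive directions u ∈ ℤ² and def_u(B) = max(m - ω_u(B), 0). -/

import Mathlib

open Finset Set

/-- Embedding of lattice points into the real plane. -/
def toR (p : ℤ × ℤ) : ℝ × ℝ := ((p.1 : ℝ), (p.2 : ℝ))

/-- Integer pairing `u ⋅ p`. -/
def zdot (u p : ℤ × ℤ) : ℤ := u.1 * p.1 + u.2 * p.2

/-- The lattice points of the convex hull of `B` (the `ℤ`-convex hull). -/
def latticeHull (B : Finset (ℤ × ℤ)) : Set (ℤ × ℤ) :=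
  {p | toR p ∈ convexHull ℝ (toR '' (B : Set (ℤ × ℤ)))}

/-- The lattice width of `B` in the direction `u`. -/
def widthZ (u : ℤ × ℤ) (B : Finset (ℤ × ℤ)) (h : B.Nonempty) : ℤ :=
  B.sup' h (zdot u) - B.inf' h (zdot u)

/-- Lattice points of the face of the hull of `B` where `u ⋅ p` is maximal
(the side of the polygon perpendicular to `u` on the `max` side). -/
def maxFace (u : ℤ × ℤ) (B : Finset (ℤ × ℤ)) (h : B.Nonempty) : Set (ℤ × ℤ) :=
  {p ∈ latticeHull B | zdot u p = B.sup' h (zdot u)}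

/-- Lattice points of the face of the hull of `B` where `u ⋅ p` is minimal. -/
def minFace (u : ℤ × ℤ) (B : Finset (ℤ × ℤ)) (h : B.Nonempty) : Set (ℤ × ℤ) :=
  {p ∈ latticeHull B | zdot u p = B.inf' h (zdot u)}

/-- A finite set `B ⊆ ℤ²` is `m`-thick: it is empty, or its hull is a segment of
integer length at least `m` (i.e. containing at least `m + 1` lattice points), or its hull
is two-dimensional and for every direction `u` in which the lattice width of the
`ℤ`-convex hull is `m - a` with `a > 0`, the hull has two sides perpendicular to `u`
each of integer length at least `a` (i.e. containing at least `a + 1` lattice points). -/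
def MThick (m : ℕ) (B : Finset (ℤ × ℤ)) : Prop :=
  B = ∅ ∨
  (∃ h : B.Nonempty, Collinear ℝ (toR '' (B : Set (ℤ × ℤ))) ∧
    (m : ℤ) + 1 ≤ ((latticeHull B).ncard : ℤ)) ∨
  (∃ h : B.Nonempty, ¬ Collinear ℝ (toR '' (B : Set (ℤ × ℤ))) ∧
    ∀ u : ℤ × ℤ, u ≠ 0 → ∀ a : ℤ, 0 < a → widthZ u B h = (m : ℤ) - a →
      a + 1 ≤ ((maxFace u B h).ncard : ℤ) ∧ a + 1 ≤ ((minFace u B h).ncard : ℤ))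

open MeasureTheory in
/-- The Euclidean area of the convex hull of the lattice points `B`. -/
noncomputable def areaOf (B : Finset (ℤ × ℤ)) : ℝ :=
  (MeasureTheory.volume (convexHull ℝ (toR '' (B : Set (ℤ × ℤ))))).toReal

/-- `u` is a primitive direction: its coordinates are coprime, and we pick one
representative of each pair `{u, -u}`. -/
def IsPrimDir (u : ℤ × ℤ) : Prop :=
  IsCoprime u.1 u.2 ∧ (0 < u.2 ∨ (u.2 = 0 ∧ 0 < u.1))

/-- The defect of `B` in the direction `u`: `max (m - ω_u(B)) 0`. -/
def defect (m : ℕ) (u : ℤ × ℤ) (B : Finset (ℤ × ℤ)) (h : B.Nonempty) : ℤ :=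
  max ((m : ℤ) - widthZ u B h) 0


/-- The open standard simplex has area `1/2`. -/
lemma vol_simplex :
    MeasureTheory.volume (regionBetween (fun _ : ℝ => (0:ℝ)) (fun x => 1 - x) (Set.Ioo 0 1))
      = ENNReal.ofReal (1/2) := by
  rw [MeasureTheory.Measure.volume_eq_prod, volume_regionBetween_eq_integral]
  · congr 1
    rw [← MeasureTheory.integral_Ioc_eq_integral_Ioo,
      ← intervalIntegral.integral_of_le (by norm_num)]
    simp only [Pi.sub_apply, sub_zero]
    rw [intervalIntegral.integral_sub (by simp) (by simp)]
    simp
    norm_num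
  · exact (continuousOn_const.integrableOn_Icc (μ := MeasureTheory.volume)
      (a := (0:ℝ)) (b := 1)).mono_set Set.Ioo_subset_Icc_self
  · exact ((by fun_prop : ContinuousOn (fun x : ℝ => 1 - x) (Set.Icc 0 1)).integrableOn_Icc
      (μ := MeasureTheory.volume)).mono_set Set.Ioo_subset_Icc_self
  · exact measurableSet_Ioo
  · intro x hx
    have := hx.2
    linarith

/-- planar determinant of `q - p` and `s - r` -/
def detR (p q r s : ℝ × ℝ) : ℝ := (q.1 - p.1) * (s.2 - r.2) - (q.2 - p.2) * (s.1 - r.1)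

lemma tri_area (K : Set (ℝ × ℝ)) (hK : Convex ℝ K) (p q r : ℝ × ℝ) (hp : p ∈ K) (hq : q ∈ K)
    (hr : r ∈ K) :
    ENNReal.ofReal (detR p q p r / 2) ≤ MeasureTheory.volume (K ∩ {z | 0 < detR p q p z}) := by
  by_cases hD : detR p q p r ≤ 0
  · rw [ENNReal.ofReal_of_nonpos (by linarith)]; exact zero_le
  push Not at hD
  set f : (ℝ × ℝ) →ₗ[ℝ] (ℝ × ℝ) := Matrix.toLin (Module.Basis.finTwoProd ℝ)
    (Module.Basis.finTwoProd ℝ) !![q.1 - p.1, r.1 - p.1; q.2 - p.2, r.2 - p.2] with hf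
  have hdet : LinearMap.det f = detR p q p r := by
    rw [hf, LinearMap.det_toLin, Matrix.det_fin_two_of, detR]; ring
  have hfa : ∀ z, f z = ((q.1 - p.1) * z.1 + (r.1 - p.1) * z.2,
      (q.2 - p.2) * z.1 + (r.2 - p.2) * z.2) := by
    intro z
    rw [hf, Matrix.toLin_finTwoProd_apply]
  set S := regionBetween (fun _ : ℝ => (0:ℝ)) (fun x => 1 - x) (Set.Ioo 0 1) with hS
  have hvol : MeasureTheory.volume ((fun z => p + z) '' (f '' S)) =
      ENNReal.ofReal (detR p q p r / 2) := by
    rw [Set.image_add_left, MeasureTheory.measure_preimage_add,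
      MeasureTheory.Measure.addHaar_image_linearMap, hdet, hS, vol_simplex,
      ← ENNReal.ofReal_mul (abs_nonneg _), abs_of_pos hD]
    congr 1; ring
  rw [← hvol]
  apply MeasureTheory.measure_mono
  rintro _ ⟨_, ⟨z, hz, rfl⟩, rfl⟩
  obtain ⟨⟨h1, h2⟩, h3, h4⟩ := hz
  simp only at h3 h4
  constructor
  · have h := hK.sum_mem (t := Finset.univ) (w := ![1 - z.1 - z.2, z.1, z.2]) (z := ![p, q, r])
      (by intro i _; fin_cases i <;> simp <;> linarith)
      (by simp [Fin.sum_univ_three]; ring)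
      (by intro i _; fin_cases i <;> simp [hp, hq, hr])
    convert h using 1
    simp only [Fin.sum_univ_three, hfa]
    ext <;> simp <;> ring
  · simp only [Set.mem_ofPred_eq, hfa, detR, Prod.fst_add, Prod.snd_add]
    have : 0 < z.2 * detR p q p r := mul_pos h3 hD
    rw [detR] at this
    linarith

lemma chord_area (K : Set (ℝ × ℝ)) (hK : Convex ℝ K) (hfin : MeasureTheory.volume K ≠ ⊤)
    (p q r s : ℝ × ℝ) (hp : p ∈ K) (hq : q ∈ K) (hr : r ∈ K) (hs : s ∈ K) :
    detR p q r s ≤ 2 * (MeasureTheory.volume K).toReal := by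
  have h1 := tri_area K hK p q s hp hq hs
  have h2 := tri_area K hK q p r hq hp hr
  set U : Set (ℝ × ℝ) := {z | 0 < detR p q p z} with hU
  have hUm : MeasurableSet U := by
    apply IsOpen.measurableSet
    exact isOpen_lt continuous_const (by unfold detR; fun_prop)
  have h3 : MeasureTheory.volume (K ∩ {z | 0 < detR q p q z}) ≤ MeasureTheory.volume (K \ U) := by
    apply MeasureTheory.measure_mono
    rintro z ⟨hz, hz2⟩
    refine ⟨hz, fun hz3 => ?_⟩
    simp only [hU, Set.mem_ofPred_eq, detR] at hz2 hz3
    linarith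
  have h4 := MeasureTheory.measure_inter_add_sdiff (μ := MeasureTheory.volume) K hUm
  have h5 : ENNReal.ofReal (detR p q p s / 2) + ENNReal.ofReal (detR q p q r / 2) ≤
      MeasureTheory.volume K := by
    rw [← h4]; exact add_le_add h1 (h2.trans h3)
  have h6 := ENNReal.toReal_mono hfin h5
  rw [ENNReal.toReal_add ENNReal.ofReal_ne_top ENNReal.ofReal_ne_top,
    ENNReal.toReal_ofReal', ENNReal.toReal_ofReal'] at h6
  have h7 := le_max_left (detR p q p s / 2) 0
  have h8 := le_max_left (detR q p q r / 2) 0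
  have h9 : detR p q r s = detR p q p s + detR q p q r := by simp only [detR]; ring
  linarith

lemma area_ge (B : Finset (ℤ × ℤ)) (p q r s : ℤ × ℤ) (hp : p ∈ B) (hq : q ∈ B) (hr : r ∈ B)
    (hs : s ∈ B) :
    (((q.1 - p.1) * (s.2 - r.2) - (q.2 - p.2) * (s.1 - r.1) : ℤ) : ℝ) ≤ 2 * areaOf B := by
  have hsub := subset_convexHull ℝ (toR '' (B : Set (ℤ × ℤ)))
  have hfin : MeasureTheory.volume (convexHull ℝ (toR '' (B : Set (ℤ × ℤ)))) ≠ ⊤ :=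
    ((B.finite_toSet.image toR).isCompact_convexHull (𝕜 := ℝ)).measure_lt_top.ne
  have := chord_area _ (convex_convexHull ℝ _) hfin (toR p) (toR q) (toR r) (toR s)
    (hsub ⟨p, hp, rfl⟩) (hsub ⟨q, hq, rfl⟩) (hsub ⟨r, hr, rfl⟩) (hsub ⟨s, hs, rfl⟩)
  simp only [detR, toR] at this
  push_cast
  exact this

lemma area_ge_uv (B : Finset (ℤ × ℤ)) (u v p q r s : ℤ × ℤ) (huv : u.1 * v.2 - u.2 * v.1 = 1)
    (hp : p ∈ B) (hq : q ∈ B) (hr : r ∈ B) (hs : s ∈ B) :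
    (((zdot u q - zdot u p) * (zdot v s - zdot v r)
      - (zdot v q - zdot v p) * (zdot u s - zdot u r) : ℤ) : ℝ) ≤ 2 * areaOf B := by
  have := area_ge B p q r s hp hq hr hs
  convert this using 2
  simp only [zdot]
  linear_combination ((q.1 - p.1) * (s.2 - r.2) - (q.2 - p.2) * (s.1 - r.1)) * huv

lemma sub_le_widthZ (u : ℤ × ℤ) (B : Finset (ℤ × ℤ)) (h : B.Nonempty) (p q : ℤ × ℤ)
    (hp : p ∈ B) (hq : q ∈ B) : zdot u p - zdot u q ≤ widthZ u B h := by
  have h1 := Finset.le_sup' (zdot u) hp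
  have h2 := Finset.inf'_le (zdot u) hq
  unfold widthZ
  linarith

lemma widthZ_attained (u : ℤ × ℤ) (B : Finset (ℤ × ℤ)) (h : B.Nonempty) :
    ∃ p ∈ B, ∃ q ∈ B, widthZ u B h = zdot u p - zdot u q := by
  obtain ⟨p, hp, h1⟩ := Finset.exists_mem_eq_sup' h (zdot u)
  obtain ⟨q, hq, h2⟩ := Finset.exists_mem_eq_inf' h (zdot u)
  exact ⟨p, hp, q, hq, by rw [widthZ, h1, h2]⟩

lemma zdot_neg (u p : ℤ × ℤ) : zdot (-u) p = - zdot u p := by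
  simp [zdot]; ring

lemma widthZ_neg (u : ℤ × ℤ) (B : Finset (ℤ × ℤ)) (h : B.Nonempty) :
    widthZ (-u) B h = widthZ u B h := by
  obtain ⟨p, hp, q, hq, h1⟩ := widthZ_attained u B h
  obtain ⟨p', hp', q', hq', h2⟩ := widthZ_attained (-u) B h
  have h3 := sub_le_widthZ u B h q' p' hq' hp'
  have h4 := sub_le_widthZ (-u) B h q p hq hp
  simp only [zdot_neg] at h2 h4
  linarith

lemma widthZ_nonneg (u : ℤ × ℤ) (B : Finset (ℤ × ℤ)) (h : B.Nonempty) :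
    0 ≤ widthZ u B h := by
  obtain ⟨p, hp⟩ := h
  have := sub_le_widthZ u B ⟨p, hp⟩ p p hp hp
  linarith

lemma spread (B : Finset (ℤ × ℤ)) (S : Set (ℤ × ℤ)) (hS : S ⊆ B) (f : ℤ × ℤ → ℤ)
    (hf : Set.InjOn f S) (a : ℤ) (ha : 0 < a) (hcard : a + 1 ≤ (S.ncard : ℤ)) :
    ∃ p ∈ S, ∃ q ∈ S, a ≤ f q - f p := by
  have hfin : S.Finite := B.finite_toSet.subset hS
  have hne : S.Nonempty := by
    rw [Set.nonempty_iff_ne_empty]; rintro rfl; simp at hcard; omega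
  obtain ⟨p, hp, hpm⟩ := Set.exists_min_image S f hfin hne
  obtain ⟨q, hq, hqm⟩ := Set.exists_max_image S f hfin hne
  refine ⟨p, hp, q, hq, ?_⟩
  have h1 : S.ncard ≤ ((Finset.Icc (f p) (f q) : Finset ℤ) : Set ℤ).ncard := by
    apply Set.ncard_le_ncard_of_injOn f _ hf (Finset.finite_toSet _)
    · intro x hx
      simp [hpm x hx, hqm x hx]
  rw [Set.ncard_coe_finset, Int.card_Icc] at h1
  omega

lemma inj_level (u v : ℤ × ℤ) (huv : u.1 * v.2 - u.2 * v.1 ≠ 0) (p q : ℤ × ℤ)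
    (h1 : zdot u p = zdot u q) (h2 : zdot v p = zdot v q) : p = q := by
  simp only [zdot] at h1 h2
  ext
  · apply mul_left_cancel₀ huv; linear_combination v.2 * h1 - u.2 * h2
  · apply mul_left_cancel₀ huv; linear_combination u.1 * h2 - v.1 * h1

/-- Points on the two faces perpendicular to `u`, spread out by the defect. -/
lemma faces (m : ℕ) (B : Finset (ℤ × ℤ)) (h : B.Nonempty)
    (hconv : latticeHull B = (B : Set (ℤ × ℤ)))
    (hth : ∀ u : ℤ × ℤ, u ≠ 0 → ∀ a : ℤ, 0 < a → widthZ u B h = (m : ℤ) - a →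
      a + 1 ≤ ((maxFace u B h).ncard : ℤ) ∧ a + 1 ≤ ((minFace u B h).ncard : ℤ))
    (u v : ℤ × ℤ) (huv : u.1 * v.2 - u.2 * v.1 ≠ 0) :
    ∃ t1 ∈ B, ∃ t2 ∈ B, ∃ b1 ∈ B, ∃ b2 ∈ B,
      zdot u t1 - zdot u b1 = widthZ u B h ∧ zdot u t2 = zdot u t1 ∧ zdot u b2 = zdot u b1 ∧
      defect m u B h ≤ zdot v t2 - zdot v t1 ∧ defect m u B h ≤ zdot v b2 - zdot v b1 := by
  by_cases ha : (m : ℤ) - widthZ u B h ≤ 0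
  · obtain ⟨p, hp, q, hq, h1⟩ := widthZ_attained u B h
    refine ⟨p, hp, p, hp, q, hq, q, hq, h1.symm, rfl, rfl, ?_, ?_⟩ <;> simp [defect, ha]
  · push Not at ha
    have hu : u ≠ 0 := by rintro rfl; simp at huv
    obtain ⟨c1, c2⟩ := hth u hu _ ha (by ring)
    have hd : defect m u B h = (m : ℤ) - widthZ u B h := max_eq_left ha.le
    obtain ⟨t1, ht1, t2, ht2, ht⟩ := spread B (maxFace u B h)
      (fun p hp => hconv ▸ hp.1) (zdot v)
      (fun p hp q hq e => inj_level u v huv p q (hp.2.trans hq.2.symm) e) _ ha c1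
    obtain ⟨b1, hb1, b2, hb2, hb⟩ := spread B (minFace u B h)
      (fun p hp => hconv ▸ hp.1) (zdot v)
      (fun p hp q hq e => inj_level u v huv p q (hp.2.trans hq.2.symm) e) _ ha c2
    have key : ∀ p, p ∈ latticeHull B → p ∈ B := fun p hp => by rw [hconv] at hp; exact hp
    refine ⟨t1, key _ ht1.1, t2, key _ ht2.1, b1, key _ hb1.1, b2, key _ hb2.1, ?_,
      ht2.2.trans ht1.2.symm, hb2.2.trans hb1.2.symm, hd ▸ ht, hd ▸ hb⟩
    rw [ht1.2, hb1.2, widthZ]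

lemma exists_primDir (v : ℤ × ℤ) (hv : IsCoprime v.1 v.2) :
    ∃ v', IsPrimDir v' ∧ (v' = v ∨ v' = -v) := by
  rcases lt_trichotomy v.2 0 with h2 | h2 | h2
  · exact ⟨-v, ⟨hv.neg_neg, Or.inl (by simpa using h2)⟩, Or.inr rfl⟩
  · rcases lt_trichotomy v.1 0 with h1 | h1 | h1
    · exact ⟨-v, ⟨hv.neg_neg, Or.inr (by simpa using ⟨h2, h1⟩)⟩, Or.inr rfl⟩
    · rw [h1, h2] at hv; exact absurd hv not_isCoprime_zero_zero
    · exact ⟨v, ⟨hv, Or.inr ⟨h2, h1⟩⟩, Or.inl rfl⟩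
  · exact ⟨v, ⟨hv, Or.inl h2⟩, Or.inl rfl⟩

/-- Three points of `B` spanning a nondegenerate triangle. -/
lemma exists_nondeg (B : Finset (ℤ × ℤ)) (h2dim : ¬ Collinear ℝ (toR '' (B : Set (ℤ × ℤ))))
    (p : ℤ × ℤ) (hp : p ∈ B) :
    ∃ q ∈ B, ∃ r ∈ B, (q.1 - p.1) * (r.2 - p.2) - (q.2 - p.2) * (r.1 - p.1) ≠ 0 := by
  by_contra! hcon
  apply h2dim
  have hmem : toR p ∈ toR '' (B : Set (ℤ × ℤ)) := ⟨p, hp, rfl⟩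
  rw [collinear_iff_of_mem hmem]
  by_cases hs : ∀ q ∈ B, q = p
  · refine ⟨0, ?_⟩
    rintro _ ⟨q, hq, rfl⟩
    exact ⟨0, by rw [hs q hq]; simp⟩
  · push Not at hs
    obtain ⟨q, hq, hne⟩ := hs
    refine ⟨toR q - toR p, ?_⟩
    rintro _ ⟨r, hr, rfl⟩
    have h0 := hcon q hq r hr
    have h0' : ((q.1:ℝ) - p.1) * (r.2 - p.2) - (q.2 - p.2) * (r.1 - p.1) = 0 := by
      exact_mod_cast h0
    have hN : ((q.1:ℝ) - p.1)^2 + ((q.2:ℝ) - p.2)^2 ≠ 0 := by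
      intro hz
      have e1 : ((q.1:ℝ) - p.1) = 0 := by nlinarith [sq_nonneg ((q.1:ℝ) - p.1), sq_nonneg ((q.2:ℝ) - p.2)]
      have e2 : ((q.2:ℝ) - p.2) = 0 := by nlinarith [sq_nonneg ((q.1:ℝ) - p.1), sq_nonneg ((q.2:ℝ) - p.2)]
      apply hne
      ext
      · exact_mod_cast sub_eq_zero.mp e1
      · exact_mod_cast sub_eq_zero.mp e2
    refine ⟨(((q.1:ℝ) - p.1) * (r.1 - p.1) + ((q.2:ℝ) - p.2) * (r.2 - p.2)) /
      (((q.1:ℝ) - p.1)^2 + ((q.2:ℝ) - p.2)^2), ?_⟩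
    ext
    · simp [toR]
      field_simp
      linear_combination (-((q.2:ℝ) - p.2)) * h0'
    · simp [toR]
      field_simp
      linear_combination (((q.1:ℝ) - p.1)) * h0'

lemma defect_nonneg (m : ℕ) (u : ℤ × ℤ) (B : Finset (ℤ × ℤ)) (h : B.Nonempty) :
    0 ≤ defect m u B h := le_max_right _ _

lemma defect_summable (m : ℕ) (B : Finset (ℤ × ℤ)) (h : B.Nonempty)
    (h2dim : ¬ Collinear ℝ (toR '' (B : Set (ℤ × ℤ)))) :
    Summable (fun u : {u : ℤ × ℤ // IsPrimDir u} => ((defect m u.1 B h : ℤ) : ℝ) ^ 2) := by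
  apply summable_of_hasFiniteSupport
  obtain ⟨p, hp⟩ := id h
  obtain ⟨q, hq, r, hr, hne⟩ := exists_nondeg B h2dim p hp
  let g : {u : ℤ × ℤ // IsPrimDir u} → ℤ × ℤ := fun u =>
    (zdot u.1 q - zdot u.1 p, zdot u.1 r - zdot u.1 p)
  have hg : Function.Injective g := by
    intro u v huv
    simp only [g, zdot, Prod.mk.injEq] at huv
    obtain ⟨e1, e2⟩ := huv
    apply Subtype.ext
    ext
    · apply mul_left_cancel₀ hne
      linear_combination (r.2 - p.2) * e1 - (q.2 - p.2) * e2
    · apply mul_left_cancel₀ hne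
      linear_combination (q.1 - p.1) * e2 - (r.1 - p.1) * e1
  apply Set.Finite.of_finite_image (f := g) _ hg.injOn
  apply ((Set.finite_Icc (-(m:ℤ)) m).prod (Set.finite_Icc (-(m:ℤ)) m)).subset
  rintro _ ⟨u, hu, rfl⟩
  have hw : widthZ u.1 B h ≤ m := by
    by_contra! hc
    apply hu
    have : defect m u.1 B h = 0 := max_eq_right (by omega)
    simp [this]
  have h1 := sub_le_widthZ u.1 B h q p hq hp
  have h2 := sub_le_widthZ u.1 B h p q hp hq
  have h3 := sub_le_widthZ u.1 B h r p hr hp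
  have h4 := sub_le_widthZ u.1 B h p r hp hr
  simp only [g, Set.mem_prod, Set.mem_Icc]
  omega

/-- The final numerical inequality. -/
lemma numeric (m w w2 a b e d1 d2 A : ℝ) (hm : 0 ≤ m) (hw : 0 ≤ w) (hww : w ≤ w2)
    (ha : a = max (m - w) 0) (hb : b = max (m - w2) 0)
    (he1 : e ≤ w - b) (he2 : -(w - b) ≤ e)
    (hd1 : d1 ≤ w / 2 - a) (hd2 : -(w / 2 - a) ≤ d2)
    (hA1 : w * w2 - d1 * e ≤ A) (hA2 : w * w2 - d2 * e ≤ A) :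
    m ^ 2 ≤ 2 * A + a ^ 2 + b ^ 2 := by
  have hA : w * w2 - (w / 2 - a) * |e| ≤ A := by
    rcases le_total 0 e with h | h
    · rw [abs_of_nonneg h]; nlinarith
    · rw [abs_of_nonpos h]; nlinarith
  have he : |e| ≤ w - b := abs_le.mpr ⟨he2, he1⟩
  have he0 := abs_nonneg e
  generalize |e| = E at *
  have hb0 : 0 ≤ b := hb ▸ le_max_right _ _
  have hb1 : m - b ≤ w2 := by have := le_max_left (m - w2) 0; linarith
  have hba : b ≤ a := by
    rw [ha, hb]; exact max_le_max (by linarith) le_rfl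
  have hp : w * w2 ≥ w * (m - b) := mul_le_mul_of_nonneg_left hb1 hw
  rcases le_total m w with h | h
  · rw [max_eq_right (by linarith)] at ha
    rw [ha] at hA hba ⊢
    have : b = 0 := le_antisymm hba hb0
    subst this
    nlinarith
  · rw [max_eq_left (by linarith)] at ha
    have hwe : w = m - a := by linarith
    subst hwe
    rcases le_total a ((m - a) / 2) with h3 | h3
    · have : ((m - a) / 2 - a) * E ≤ ((m - a) / 2 - a) * (m - a - b) :=
        mul_le_mul_of_nonneg_left he (by linarith)
      nlinarith [mul_nonneg (by linarith : 0 ≤ m - a - b) (by linarith : 0 ≤ 2 * a - b)]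
    · have : ((m - a) / 2 - a) * E ≤ 0 := mul_nonpos_of_nonpos_of_nonneg (by linarith) he0
      nlinarith [sq_nonneg (m - a - b)]

lemma exists_shear (c w : ℤ) (hw : 0 < w) : ∃ k : ℤ, 2 * (c + k * w) ≤ w ∧ -w ≤ 2 * (c + k * w) := by
  refine ⟨-((2 * c + w) / (2 * w)), ?_⟩
  have h1 := Int.emod_add_mul_ediv (2 * c + w) (2 * w)
  have h2 := Int.emod_nonneg (2 * c + w) (by omega : 2 * w ≠ 0)
  have h3 := Int.emod_lt_of_pos (2 * c + w) (by omega : 0 < 2 * w)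
  constructor <;> nlinarith

theorem two_area_plus_defects_ge_half (m : ℕ) (B : Finset (ℤ × ℤ)) (h : B.Nonempty)
    (hconv : latticeHull B = (B : Set (ℤ × ℤ)))
    (h2dim : ¬ Collinear ℝ (toR '' (B : Set (ℤ × ℤ))))
    (hthick : MThick m B) :
    (1 / 2 : ℝ) * (m : ℝ) ^ 2 ≤
      2 * areaOf B + (1 / 2 : ℝ) *
        ∑' u : {u : ℤ × ℤ // IsPrimDir u}, ((defect m u.1 B h : ℤ) : ℝ) ^ 2 := by
  have hth : ∀ u : ℤ × ℤ, u ≠ 0 → ∀ a : ℤ, 0 < a → widthZ u B h = (m : ℤ) - a →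
      a + 1 ≤ ((maxFace u B h).ncard : ℤ) ∧ a + 1 ≤ ((minFace u B h).ncard : ℤ) := by
    rcases hthick with h0 | ⟨_, h1, _⟩ | ⟨_, _, h2⟩
    · exact absurd h0 h.ne_empty
    · exact absurd h1 h2dim
    · exact h2
  have hsum := defect_summable m B h h2dim
  -- a primitive direction of minimal width
  obtain ⟨⟨u, hu⟩, hmin⟩ : ∃ u : {u : ℤ × ℤ // IsPrimDir u},
      ∀ v : {u : ℤ × ℤ // IsPrimDir u}, widthZ u.1 B h ≤ widthZ v.1 B h := by
    have : Nonempty {u : ℤ × ℤ // IsPrimDir u} :=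
      ⟨⟨(1, 0), isCoprime_one_left, Or.inr ⟨rfl, by norm_num⟩⟩⟩
    let F : {u : ℤ × ℤ // IsPrimDir u} → ℕ := fun u => (widthZ u.1 B h).toNat
    refine ⟨Function.argmin F, fun v => ?_⟩
    have h1 : F (Function.argmin F) ≤ F v := Function.argmin_le F v
    have h2 := widthZ_nonneg (Function.argmin F).1 B h
    have h3 := widthZ_nonneg v.1 B h
    change (widthZ (Function.argmin F).1 B h).toNat ≤ (widthZ v.1 B h).toNat at h1
    omega
  simp only at hmin
  have hw0 := widthZ_nonneg u B h
  rcases hw0.eq_or_lt with hw | hw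
  · have h1 := hsum.le_tsum ⟨u, hu⟩ (fun _ _ => sq_nonneg _)
    have h2 : defect m u B h = m := by rw [defect, ← hw]; simp
    simp only [h2] at h1
    have h3 : 0 ≤ areaOf B := ENNReal.toReal_nonneg
    push_cast at h1
    linarith
  -- complete to a basis, then shear
  obtain ⟨x, y, hxy⟩ := hu.1
  obtain ⟨t1, ht1, t2, ht2, b1, hb1, b2, hb2, hwid, et, eb, hdt, hdb⟩ :=
    faces m B h hconv hth u (-y, x) (by simp; linarith)
  obtain ⟨k, hk1, hk2⟩ := exists_shear
    (zdot (-y, x) t1 - zdot (-y, x) b2 + defect m u B h) (widthZ u B h) hw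
  set v : ℤ × ℤ := (-y + k * u.1, x + k * u.2) with hv
  have huv : u.1 * v.2 - u.2 * v.1 = 1 := by simp only [hv]; linarith
  have hzv : ∀ p, zdot v p = zdot (-y, x) p + k * zdot u p := by
    intro p; simp only [zdot, hv]; ring
  obtain ⟨r1, hr1, r2, hr2, l1, hl1, l2, hl2, hwid2, er, el, hdr, hdl⟩ :=
    faces m B h hconv hth v u (by intro h0; linarith)
  have hvc : IsCoprime v.1 v.2 := ⟨-u.2, u.1, by linarith⟩
  obtain ⟨v', hv', hvv⟩ := exists_primDir v hvc
  have hwv : widthZ v' B h = widthZ v B h := by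
    rcases hvv with rfl | rfl
    · rfl
    · exact widthZ_neg _ _ _
  have hne : (⟨u, hu⟩ : {u : ℤ × ℤ // IsPrimDir u}) ≠ ⟨v', hv'⟩ := by
    intro h0
    have h1 : u = v' := congrArg Subtype.val h0
    have h2 : v = u ∨ v = -u := by
      rcases hvv with h3 | h3
      · left; rw [h1, h3]
      · right; rw [h1, h3, neg_neg]
    rcases h2 with h2 | h2
    · rw [h2] at huv; linarith
    · rw [h2] at huv; simp only [Prod.fst_neg, Prod.snd_neg] at huv; linarith
  have hdef : defect m v' B h = defect m v B h := by rw [defect, defect, hwv]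
  have hs2 := hsum.sum_le_tsum {⟨u, hu⟩, ⟨v', hv'⟩} (fun _ _ => sq_nonneg _)
  rw [Finset.sum_pair hne] at hs2
  simp only [hdef] at hs2
  have hww := hmin ⟨v', hv'⟩
  simp only [hwv] at hww
  have hA1 := area_ge_uv B u v b2 t1 l1 r1 huv hb2 ht1 hl1 hr1
  have hA2 := area_ge_uv B u v b1 t2 l1 r1 huv hb1 ht2 hl1 hr1
  have q1 := sub_le_widthZ u B h r2 l1 hr2 hl1
  have q2 := sub_le_widthZ u B h l2 r1 hl2 hr1
  have k1 : zdot v t1 - zdot v b2 = zdot (-y, x) t1 - zdot (-y, x) b2 + k * widthZ u B h := by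
    rw [hzv, hzv, eb, ← hwid]; ring
  have k2 : zdot v t2 - zdot v b1 = zdot (-y, x) t2 - zdot (-y, x) b1 + k * widthZ u B h := by
    rw [hzv, hzv, et, ← hwid]; ring
  have z1 : 2 * (zdot v t1 - zdot v b2) ≤ widthZ u B h - 2 * defect m u B h := by linarith
  have z2 : -(widthZ u B h - 2 * defect m u B h) ≤ 2 * (zdot v t2 - zdot v b1) := by linarith
  have z3 : zdot u r1 - zdot u l1 ≤ widthZ u B h - defect m v B h := by linarith
  have z4 : -(widthZ u B h - defect m v B h) ≤ zdot u r1 - zdot u l1 := by linarith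
  rw [eb, hwid, hwid2] at hA1
  rw [et, hwid, hwid2] at hA2
  have key := numeric (m : ℝ) (widthZ u B h : ℤ) (widthZ v B h : ℤ) (defect m u B h : ℤ)
    (defect m v B h : ℤ) (zdot u r1 - zdot u l1 : ℤ) (zdot v t1 - zdot v b2 : ℤ)
    (zdot v t2 - zdot v b1 : ℤ) (2 * areaOf B) (by positivity) (by exact_mod_cast hw0)
    (by exact_mod_cast hww) (by simp [defect]) (by simp [defect])
    (by exact_mod_cast z3) (by exact_mod_cast z4)
    (by have : (2:ℝ) * (zdot v t1 - zdot v b2 : ℤ) ≤ (widthZ u B h : ℤ) - 2 * (defect m u B h : ℤ) := by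
          exact_mod_cast z1
        linarith)
    (by have : -((widthZ u B h : ℤ) - 2 * (defect m u B h : ℤ)) ≤ (2:ℝ) * (zdot v t2 - zdot v b1 : ℤ) := by
          exact_mod_cast z2
        linarith)
    (by exact_mod_cast hA1) (by exact_mod_cast hA2)
  linarith
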